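/- arXiv:2002.10162 — 6 statements merged into one kernel-verified Lean document; each statement's English description precedes it below -/
import Mathlib

section
/- Let q be a real number with q > 0 and q ≠ 1, let x be real, let k ≥ 1, and let r_1,…,r_k be nonnegative integers, with the convention that a q-multinomial coefficient with a negative lower argument equals 0. Then [x; r_1,…,r_k]_q = [x−1; r_1,…,r_k]_q + Σ_{i=1}^{k} q^{x−m_i} · [x−1; r_1,…,r_{i−1}, r_i−1, r_{i+1},…,r_k]_q, where m_i = r_i + r_{i+1} + ⋯ + r_k and q^{x−m_i} denotes the real power. -/
open Finset Filter Classical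

noncomputable def qNum (q x : ℝ) : ℝ := (1 - q ^ x) / (1 - q)

noncomputable def qFact (q x : ℝ) (r : ℕ) : ℝ :=
  ∏ i ∈ Finset.range r, qNum q (x - i)

noncomputable def qFactorial (q : ℝ) (r : ℕ) : ℝ :=
  ∏ i ∈ Finset.range r, qNum q (i + 1)

noncomputable def qBinom (q x : ℝ) (r : ℕ) : ℝ := qFact q x r / qFactorial q r

noncomputable def qMultinom {k : ℕ} (q x : ℝ) (r : Fin k → ℕ) : ℝ :=
  qFact q x (∑ i, r i) / ∏ i, qFactorial q (r i)

/-- `q`-multinomial coefficient allowing integer lower arguments, with the convention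
that it equals `0` if some lower argument is negative. -/
noncomputable def qMultinomZ (q x : ℝ) (k : ℕ) (r : ℕ → ℤ) : ℝ :=
  if ∀ i < k, 0 ≤ r i then
    qFact q x (∑ i ∈ Finset.range k, r i).toNat /
      ∏ i ∈ Finset.range k, qFactorial q (r i).toNat
  else 0

theorem qFact_eq_add_sub (q x : ℝ) (n : ℕ) :
    qFact q x n = qFact q (x - 1) n + qFact q (x - 1) (n - 1) * (qNum q x - qNum q (x - n)) := by
  cases n with
  | zero => simp [qFact]
  | succ n =>
    have h₁ : qFact q x (n + 1) = qFact q (x - 1) n * qNum q x := by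
      simp only [qFact, Finset.prod_range_succ']
      push_cast
      simp only [sub_zero, sub_sub, add_comm]
    have h₂ : qFact q (x - 1) (n + 1) = qFact q (x - 1) n * qNum q (x - (n + 1)) := by
      simp only [qFact, Finset.prod_range_succ, sub_sub, add_comm]
    rw [h₁, h₂]
    push_cast
    ring

theorem qNum_add {q : ℝ} (hq : 0 < q) (x y : ℝ) :
    qNum q (x + y) = qNum q x + q ^ x * qNum q y := by
  simp only [qNum, Real.rpow_add hq]
  ring

theorem qNum_natCast_add_one_ne_zero {q : ℝ} (hq0 : 0 < q) (hq1 : q ≠ 1) (n : ℕ) :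
    qNum q (n + 1) ≠ 0 := by
  refine div_ne_zero (sub_ne_zero.2 fun h => ?_) (sub_ne_zero.2 hq1.symm)
  rw [← Nat.cast_add_one, Real.rpow_natCast] at h
  exact hq1 ((pow_eq_one_iff_of_nonneg hq0.le n.succ_ne_zero).1 h.symm)

theorem sum_rpow_mul_qNum {q : ℝ} (hq : 0 < q) (x : ℝ) (k : ℕ) (a : ℕ → ℝ) :
    ∑ i ∈ Finset.range k, q ^ (x - ∑ j ∈ Finset.Ico i k, a j) * qNum q (a i) =
      qNum q x - qNum q (x - ∑ i ∈ Finset.range k, a i) := by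
  have h : ∀ i ∈ Finset.range k, q ^ (x - ∑ j ∈ Finset.Ico i k, a j) * qNum q (a i) =
      qNum q (x - ∑ j ∈ Finset.Ico (i + 1) k, a j) - qNum q (x - ∑ j ∈ Finset.Ico i k, a j) := by
    intro i hi
    have hsum := Finset.sum_eq_sum_Ico_succ_bot (Finset.mem_range.1 hi) a
    have hadd := qNum_add hq (x - ∑ j ∈ Finset.Ico i k, a j) (a i)
    rw [show x - ∑ j ∈ Finset.Ico i k, a j + a i = x - ∑ j ∈ Finset.Ico (i + 1) k, a j by
      rw [hsum]; ring] at hadd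
    rw [hadd]
    ring
  rw [Finset.sum_congr rfl h,
    Finset.sum_range_sub (fun i => qNum q (x - ∑ j ∈ Finset.Ico i k, a j)) k]
  simp

theorem qMultinomZ_update_sub_one {q : ℝ} (hq0 : 0 < q) (hq1 : q ≠ 1) (x : ℝ) {k : ℕ}
    {r : ℕ → ℤ} (hr : ∀ i < k, 0 ≤ r i) {i : ℕ} (hi : i < k) :
    qMultinomZ q x k (Function.update r i (r i - 1)) =
      qFact q x ((∑ j ∈ Finset.range k, r j).toNat - 1) * qNum q (r i) /
        ∏ j ∈ Finset.range k, qFactorial q (r j).toNat := by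
  obtain ⟨n, hn⟩ := Int.eq_ofNat_of_zero_le (hr i hi)
  have hmem := Finset.mem_range.2 hi
  rcases n with _ | n
  · rw [qMultinomZ, if_neg]
    · simp [hn, qNum]
    · intro h
      have := h i hi
      simp [hn] at this
  · have hpos : ∀ j < k, 0 ≤ Function.update r i (r i - 1) j := by
      intro j hj
      rcases eq_or_ne j i with rfl | hji
      · simp [hn]
      · simpa [hji] using hr j hj
    have hsum : (∑ j ∈ Finset.range k, Function.update r i (r i - 1) j).toNat =
        (∑ j ∈ Finset.range k, r j).toNat - 1 := by
      have h₁ := Finset.add_sum_erase _ (Function.update r i (r i - 1)) hmem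
      have h₂ := Finset.add_sum_erase _ r hmem
      rw [Finset.sum_congr rfl fun j hj =>
        Function.update_of_ne (Finset.ne_of_mem_erase hj) _ _, Function.update_self] at h₁
      omega
    have hprod : ∏ j ∈ Finset.range k, qFactorial q (r j).toNat = qNum q (r i) *
        ∏ j ∈ Finset.range k, qFactorial q (Function.update r i (r i - 1) j).toNat := by
      rw [← Finset.mul_prod_erase _ _ hmem, ← Finset.mul_prod_erase _
        (fun j => qFactorial q (Function.update r i (r i - 1) j).toNat) hmem, ← mul_assoc]
      congr 1
      · have h : (r i - 1).toNat = n := by omega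
        have h' : (r i).toNat = n + 1 := by omega
        rw [Function.update_self, h, h', qFactorial, Finset.prod_range_succ, mul_comm, hn]
        simp [qFactorial]
      · refine Finset.prod_congr rfl fun j hj => ?_
        rw [Function.update_of_ne (Finset.ne_of_mem_erase hj)]
    have hne : qNum q (r i) ≠ 0 := by
      simpa [hn] using qNum_natCast_add_one_ne_zero hq0 hq1 n
    rw [qMultinomZ, if_pos hpos, hsum, hprod, mul_comm (qFact _ _ _), mul_div_mul_left _ _ hne]

/-- Recurrence relation (2.3) for the `q`-multinomial coefficients:
`[x; r₁,…,r_k]_q = [x−1; r₁,…,r_k]_q + ∑_{i=1}^{k} q^{x−m_i} [x−1; …, r_i−1, …]_q`,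
where `m_i = r_i + r_{i+1} + ⋯ + r_k`. -/
theorem qMultinom_recurrence_first
    (q : ℝ) (hq0 : 0 < q) (hq1 : q ≠ 1) (x : ℝ) (k : ℕ) (hk : 1 ≤ k)
    (r : ℕ → ℤ) (hr : ∀ i < k, 0 ≤ r i) :
    qMultinomZ q x k r =
      qMultinomZ q (x - 1) k r +
        ∑ i ∈ Finset.range k,
          q ^ (x - ∑ j ∈ Finset.Ico i k, (r j : ℝ)) *
            qMultinomZ q (x - 1) k (Function.update r i (r i - 1)) := by
  have hcast : (((∑ i ∈ Finset.range k, r i).toNat : ℕ) : ℝ) =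
      ∑ i ∈ Finset.range k, (r i : ℝ) := by
    have h := Int.toNat_of_nonneg (Finset.sum_nonneg fun i hi => hr i (Finset.mem_range.1 hi))
    exact_mod_cast congrArg (Int.cast : ℤ → ℝ) h
  have hsum : ∑ i ∈ Finset.range k, q ^ (x - ∑ j ∈ Finset.Ico i k, (r j : ℝ)) *
      qMultinomZ q (x - 1) k (Function.update r i (r i - 1)) =
      qFact q (x - 1) ((∑ j ∈ Finset.range k, r j).toNat - 1) *
        (qNum q x - qNum q (x - ∑ i ∈ Finset.range k, (r i : ℝ))) /
        ∏ j ∈ Finset.range k, qFactorial q (r j).toNat := by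
    rw [← sum_rpow_mul_qNum hq0 x k fun i => (r i : ℝ), Finset.mul_sum, Finset.sum_div]
    refine Finset.sum_congr rfl fun i hi => ?_
    rw [qMultinomZ_update_sub_one hq0 hq1 (x - 1) hr (Finset.mem_range.1 hi)]
    ring
  rw [hsum, qMultinomZ, qMultinomZ, if_pos hr, if_pos hr, ← add_div, ← hcast,
    ← qFact_eq_add_sub]
end

section
/- (Multivariate q-Vandermonde formula, rising version.) Let n ≥ 1 and k ≥ 1 be integers, let q > 0 be real with q ≠ 1, and let x_1,…,x_{k+1} be real numbers. Then [x_1+x_2+⋯+x_{k+1}+n−1]_{n,q} = Σ [n; r_1,…,r_k]_q · q^{Σ_{j=1}^{k} r_j z_j} · ∏_{j=1}^{k+1}[x_j+r_j−1]_{r_j,q}, where the sum is over all nonnegative integers r_1,…,r_k with r_1+⋯+r_k ≤ n, s_j = r_1+⋯+r_j, r_{k+1} = n − s_k, z_j = x_{j+1}+x_{j+2}+⋯+x_{k+1} for j = 1,…,k, and q raised to a real exponent denotes the real power. -/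
open Finset Filter

/-- The ratio `(a; q)_n / (q; q)_n` of `q`-Pochhammer symbols. -/
def qRatio {F : Type*} [Field F] (q a : F) (n : ℕ) : F :=
  ∏ i ∈ Finset.range n, (1 - a * q ^ i) / (1 - q ^ (i + 1))

lemma qRatio_succ {F : Type*} [Field F] {q : F} (hq : ∀ n : ℕ, 1 - q ^ (n + 1) ≠ 0)
    (a : F) (n : ℕ) :
    (1 - q ^ (n + 1)) * qRatio q a (n + 1) = (1 - a * q ^ n) * qRatio q a n := by
  rw [qRatio, Finset.prod_range_succ, ← qRatio]
  field_simp [hq n]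

/-- The `q`-Vandermonde formula for normalized `q`-Pochhammer symbols. -/
lemma qRatio_mul {F : Type*} [Field F] {q : F} (hq : ∀ n : ℕ, 1 - q ^ (n + 1) ≠ 0)
    (a b : F) (n : ℕ) :
    qRatio q (a * b) n =
      ∑ p ∈ Finset.HasAntidiagonal.antidiagonal n, b ^ p.1 * qRatio q a p.1 * qRatio q b p.2 := by
  induction n with
  | zero => simp [qRatio]
  | succ n ih =>
    apply mul_left_cancel₀ (hq n)
    rw [qRatio_succ hq, ih]
    have split : (1 - q ^ (n + 1)) * ∑ p ∈ Finset.HasAntidiagonal.antidiagonal (n + 1),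
          b ^ p.1 * qRatio q a p.1 * qRatio q b p.2 =
        ∑ p ∈ Finset.HasAntidiagonal.antidiagonal (n + 1),
          b ^ p.1 * qRatio q a p.1 * ((1 - q ^ p.2) * qRatio q b p.2) +
        ∑ p ∈ Finset.HasAntidiagonal.antidiagonal (n + 1),
          b ^ p.1 * q ^ p.2 * ((1 - q ^ p.1) * qRatio q a p.1) * qRatio q b p.2 := by
      rw [Finset.mul_sum, ← Finset.sum_add_distrib]
      refine Finset.sum_congr rfl fun p hp => ?_
      rw [← Finset.HasAntidiagonal.mem_antidiagonal.mp hp, pow_add]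
      ring
    rw [split, Finset.Nat.sum_antidiagonal_succ', Finset.Nat.sum_antidiagonal_succ]
    simp only [qRatio_succ hq, pow_zero, sub_self, zero_mul, mul_zero, zero_add]
    rw [← Finset.sum_add_distrib, Finset.mul_sum]
    refine Finset.sum_congr rfl fun p hp => ?_
    rw [← Finset.HasAntidiagonal.mem_antidiagonal.mp hp, pow_add]
    ring

lemma one_sub_pow_succ_ne_zero {q : ℝ} (hq0 : 0 < q) (hq1 : q ≠ 1) (n : ℕ) :
    1 - q ^ (n + 1) ≠ 0 := by
  rw [sub_ne_zero]
  exact fun h => hq1 ((pow_eq_one_iff_of_nonneg hq0.le n.succ_ne_zero).mp h.symm)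

lemma qFactorial_ne_zero {q : ℝ} (hq0 : 0 < q) (hq1 : q ≠ 1) (n : ℕ) :
    qFactorial q n ≠ 0 := by
  refine Finset.prod_ne_zero_iff.mpr fun i _ => div_ne_zero ?_ (sub_ne_zero.mpr hq1.symm)
  exact_mod_cast one_sub_pow_succ_ne_zero hq0 hq1 i

lemma qFact_add_sub_one (q x : ℝ) (n : ℕ) :
    qFact q (x + n - 1) n = ∏ i ∈ Finset.range n, qNum q (x + i) := by
  rw [qFact, ← Finset.prod_range_reflect]
  refine Finset.prod_congr rfl fun i hi => ?_
  have hi : i + 1 ≤ n := Finset.mem_range.mp hi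
  rw [show n - 1 - i = n - (i + 1) by omega, Nat.cast_sub hi]
  push_cast
  congr 1
  ring

lemma qFact_add_sub_one_eq {q : ℝ} (hq0 : 0 < q) (hq1 : q ≠ 1) (x : ℝ) (n : ℕ) :
    qFact q (x + n - 1) n = qFactorial q n * qRatio q (q ^ x) n := by
  rw [qFact_add_sub_one, qFactorial, qRatio, ← Finset.prod_mul_distrib]
  refine Finset.prod_congr rfl fun i _ => ?_
  have h := one_sub_pow_succ_ne_zero hq0 hq1 i
  have h1 : 1 - q ≠ 0 := sub_ne_zero.mpr hq1.symm
  have h2 : q ^ ((i : ℝ) + 1) = q ^ (i + 1) := by exact_mod_cast Real.rpow_natCast q (i + 1)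
  rw [qNum, qNum, Real.rpow_add hq0, Real.rpow_natCast, h2]
  field_simp

lemma qFact_natCast_mul_qFactorial (q : ℝ) {n s : ℕ} (h : s ≤ n) :
    qFact q n s * qFactorial q (n - s) = qFactorial q n := by
  obtain ⟨t, rfl⟩ := Nat.exists_eq_add_of_le' h
  have hx : ((t + s : ℕ) : ℝ) = ((t : ℝ) + 1) + s - 1 := by push_cast; ring
  rw [hx, qFact_add_sub_one, Nat.add_sub_cancel, qFactorial, qFactorial,
    Finset.prod_range_add, mul_comm]
  congr 1
  refine Finset.prod_congr rfl fun i _ => ?_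
  push_cast
  congr 1
  ring

lemma mem_filter_piFinset_range_sum_le {k n : ℕ} {r : Fin k → ℕ} :
    r ∈ (Fintype.piFinset fun _ : Fin k => Finset.range (n + 1)).filter
      (fun r => ∑ i, r i ≤ n) ↔ ∑ i, r i ≤ n := by
  simp only [Finset.mem_filter, Fintype.mem_piFinset, Finset.mem_range, and_iff_right_iff_imp]
  exact fun h i => Nat.lt_succ_of_le
    ((Finset.single_le_sum (fun _ _ => Nat.zero_le _) (Finset.mem_univ i)).trans h)

lemma sum_filter_piFinset_succ {M : Type*} [AddCommMonoid M] (k n : ℕ)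
    (f : (Fin (k + 1) → ℕ) → M) :
    ∑ r ∈ (Fintype.piFinset fun _ : Fin (k + 1) => Finset.range (n + 1)).filter
        (fun r => ∑ i, r i ≤ n), f r =
      ∑ p ∈ Finset.HasAntidiagonal.antidiagonal n,
        ∑ r ∈ (Fintype.piFinset fun _ : Fin k => Finset.range (p.2 + 1)).filter
          (fun r => ∑ i, r i ≤ p.2), f (Fin.cons p.1 r : Fin (k + 1) → ℕ) := by
  rw [Finset.sum_sigma']
  refine Finset.sum_bij' (fun r _ => ⟨(r 0, n - r 0), Fin.tail r⟩)
    (fun p _ => (Fin.cons p.1.1 p.2 : Fin (k + 1) → ℕ)) ?_ ?_ ?_ ?_ ?_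
  · intro r hr
    rw [mem_filter_piFinset_range_sum_le, Fin.sum_univ_succ] at hr
    simp only [Finset.mem_sigma, Finset.HasAntidiagonal.mem_antidiagonal, mem_filter_piFinset_range_sum_le,
      Fin.tail]
    omega
  · rintro ⟨⟨a, b⟩, r⟩ hp
    simp only [Finset.mem_sigma, Finset.HasAntidiagonal.mem_antidiagonal,
      mem_filter_piFinset_range_sum_le] at hp
    rw [mem_filter_piFinset_range_sum_le, Fin.sum_univ_succ]
    simp only [Fin.cons_zero, Fin.cons_succ]
    omega
  · intro r _
    exact Fin.cons_self_tail r
  · rintro ⟨⟨a, b⟩, r⟩ hp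
    simp only [Finset.mem_sigma, Finset.HasAntidiagonal.mem_antidiagonal] at hp
    obtain rfl : n - a = b := by omega
    simp
  · intro r _
    exact congrArg f (Fin.cons_self_tail r).symm

lemma sum_cons_mul_sum_filter_lt {k : ℕ} (x : Fin (k + 2) → ℝ) (a : ℕ) (r : Fin k → ℕ) :
    ∑ j : Fin (k + 1), ((Fin.cons a r : Fin (k + 1) → ℕ) j : ℝ) *
        ∑ i ∈ Finset.univ.filter (fun i : Fin (k + 2) => (j : ℕ) < (i : ℕ)), x i =
      (∑ i : Fin (k + 1), x i.succ) * a + ∑ j : Fin k, (r j : ℝ) *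
        ∑ i ∈ Finset.univ.filter (fun i : Fin (k + 1) => (j : ℕ) < (i : ℕ)), x i.succ := by
  rw [Fin.sum_univ_succ, mul_comm]
  congr 1
  · rw [Finset.sum_filter, Fin.sum_univ_succ]
    simp
  · refine Finset.sum_congr rfl fun j _ => ?_
    rw [Finset.sum_filter, Finset.sum_filter, Fin.sum_univ_succ]
    simp

/-- The multivariate `q`-Vandermonde formula for normalized `q`-Pochhammer symbols. -/
lemma qRatio_rpow_sum {q : ℝ} (hq0 : 0 < q) (hq1 : q ≠ 1) (k n : ℕ) (x : Fin (k + 1) → ℝ) :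
    qRatio q (q ^ ∑ j, x j) n =
      ∑ r ∈ (Fintype.piFinset fun _ : Fin k => Finset.range (n + 1)).filter
          (fun r => ∑ i, r i ≤ n),
        q ^ (∑ j : Fin k, (r j : ℝ) *
          ∑ i ∈ Finset.univ.filter (fun i : Fin (k + 1) => (j : ℕ) < (i : ℕ)), x i) *
        ((∏ j : Fin k, qRatio q (q ^ x j.castSucc) (r j)) *
          qRatio q (q ^ x (Fin.last k)) (n - ∑ i, r i)) := by
  induction k generalizing n with
  | zero => simp [Finset.filter_true_of_mem]
  | succ k ih =>
    rw [sum_filter_piFinset_succ, Fin.sum_univ_succ, Real.rpow_add hq0,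
      qRatio_mul (one_sub_pow_succ_ne_zero hq0 hq1)]
    refine Finset.sum_congr rfl fun p hp => ?_
    rw [ih, Finset.mul_sum]
    refine Finset.sum_congr rfl fun r _ => ?_
    have hn : n - (p.1 + ∑ i, r i) = p.2 - ∑ i, r i := by
      have := Finset.HasAntidiagonal.mem_antidiagonal.mp hp
      omega
    rw [sum_cons_mul_sum_filter_lt, Fin.prod_univ_succ, Fin.sum_univ_succ (n := k) (Fin.cons _ _)]
    simp only [Fin.cons_zero, Fin.cons_succ, Fin.castSucc_zero, ← Fin.succ_castSucc,
      ← Fin.succ_last, hn]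
    rw [Real.rpow_add hq0, Real.rpow_mul hq0.le, Real.rpow_natCast]
    ring

/-- Multivariate `q`-Vandermonde formula, rising version (2.7a):
`[x₁+⋯+x_{k+1}+n−1]_{n,q} = ∑ [n; r₁,…,r_k]_q q^{∑_{j=1}^{k} r_j z_j} ∏_{j=1}^{k+1}[x_j+r_j−1]_{r_j,q}`,
summed over nonnegative integers `r₁,…,r_k` with `r₁+⋯+r_k ≤ n`, where `s_j = r₁+⋯+r_j`,
`r_{k+1} = n − s_k` and `z_j = x_{j+1}+⋯+x_{k+1}`. -/
theorem multivariate_qVandermonde_rising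
    (n k : ℕ) (hn : 1 ≤ n) (hk : 1 ≤ k)
    (q : ℝ) (hq0 : 0 < q) (hq1 : q ≠ 1) (x : Fin (k + 1) → ℝ) :
    qFact q ((∑ j, x j) + n - 1) n =
      ∑ r ∈ (Fintype.piFinset fun _ : Fin k => Finset.range (n + 1)).filter
          (fun r => ∑ i, r i ≤ n),
        qMultinom q (n : ℝ) r *
          q ^ (∑ j : Fin k,
                (r j : ℝ) *
                  ∑ i ∈ Finset.univ.filter (fun i : Fin (k + 1) => (j : ℕ) < (i : ℕ)), x i) *
          ((∏ j : Fin k, qFact q (x j.castSucc + r j - 1) (r j)) *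
            qFact q (x (Fin.last k) + ((n - ∑ i, r i : ℕ) : ℝ) - 1) (n - ∑ i, r i)) := by
  rw [qFact_add_sub_one_eq hq0 hq1, qRatio_rpow_sum hq0 hq1, Finset.mul_sum]
  refine Finset.sum_congr rfl fun r hr => ?_
  rw [mem_filter_piFinset_range_sum_le] at hr
  have hr0 : ∏ i, qFactorial q (r i) ≠ 0 :=
    Finset.prod_ne_zero_iff.mpr fun i _ => qFactorial_ne_zero hq0 hq1 (r i)
  simp only [qFact_add_sub_one_eq hq0 hq1, Finset.prod_mul_distrib, qMultinom]
  rw [← qFact_natCast_mul_qFactorial q hr]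
  field_simp
end

section
/- (Probability function of the multivariate q-Pólya distribution.) In the multiple q-Pólya urn setup, suppose r + m(i−1) ≠ 0 for every integer i with 1 ≤ i ≤ n (so [α]_{n,Q} ≠ 0 and [α−n+1]_Q ≠ 0). Then the closed-form k-variate q-Pólya probability function p_n satisfies p_0(0,…,0) = 1 and, for every n ≥ 1 and all nonnegative integers x_1,…,x_k with x_1+⋯+x_k ≤ n, the total-probability recurrence p_n(x_1,…,x_k) = p_{n−1}(x_1,…,x_k) · Q^{β_k−y_k} [α_{k+1}−x_{k+1}+1]_Q/[α−n+1]_Q + Σ_{i=1}^{k} p_{n−1}(x_1,…,x_{i−1}, x_i−1, x_{i+1},…,x_k) · Q^{β_{i−1}−y_{i−1}} [α_i−x_i+1]_Q/[α−n+1]_Q, where β_0 = 0, y_0 = 0, and p_{n−1} of any vector with a negative entry is taken to be 0. -/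
open Finset Filter Classical

/-- The closed-form `k`-variate `q`-Pólya probability function
`p_n(x₁,…,x_k) = [n; x₁,…,x_k]_Q Q^{∑_{j=1}^{k}(n−y_j)(α_j−x_j)} (∏_{j=1}^{k+1}[α_j]_{x_j,Q}) / [α]_{n,Q}`,
with `Q = q^{−m}`, `α_j = −r_j/m`, `α = −r/m`, `x_{k+1} = n−y_k`, extended by `0` to
vectors with a negative entry (or with total exceeding `n`). -/
noncomputable def polyaP (q : ℝ) (m : ℤ) {k : ℕ} (r : Fin (k + 1) → ℕ) (n : ℕ)
    (x : Fin k → ℤ) : ℝ :=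
  if (∀ j, 0 ≤ x j) ∧ ∑ j, x j ≤ (n : ℤ) then
    qMultinom (q ^ (-m)) (n : ℝ) (fun j => (x j).toNat) *
      (q ^ (-m)) ^ (∑ j : Fin k,
          ((n : ℝ) -
              ∑ i ∈ Finset.univ.filter (fun i : Fin k => (i : ℕ) ≤ (j : ℕ)), ((x i).toNat : ℝ)) *
            (-(r j.castSucc : ℝ) / (m : ℝ) - (x j).toNat)) *
      ((∏ j : Fin k, qFact (q ^ (-m)) (-(r j.castSucc : ℝ) / (m : ℝ)) (x j).toNat) *
        qFact (q ^ (-m)) (-(r (Fin.last k) : ℝ) / (m : ℝ)) (n - ∑ i, (x i).toNat)) /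
      qFact (q ^ (-m)) (-((∑ j, r j : ℕ) : ℝ) / (m : ℝ)) n
  else 0

lemma qNum_zero (Q : ℝ) : qNum Q 0 = 0 := by simp [qNum]

lemma qNum_ne_zero {Q x : ℝ} (hQ : 0 < Q) (hQ1 : Q ≠ 1) (hx : x ≠ 0) : qNum Q x ≠ 0 := by
  refine div_ne_zero (sub_ne_zero.2 fun h => ?_) (sub_ne_zero.2 hQ1.symm)
  exact hx ((Real.rpow_right_inj hQ hQ1).1 (h.symm.trans (Real.rpow_zero Q).symm))

lemma qFactorial_ne_zero_s11 {Q : ℝ} (hQ : 0 < Q) (hQ1 : Q ≠ 1) (n : ℕ) : qFactorial Q n ≠ 0 :=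
  Finset.prod_ne_zero_iff.2 fun _ _ => qNum_ne_zero hQ hQ1 (by positivity)

lemma qFactorial_succ (Q : ℝ) (n : ℕ) :
    qFactorial Q (n + 1) = qFactorial Q n * qNum Q (n + 1) := by
  simp [qFactorial, Finset.prod_range_succ]

lemma qFact_succ (Q x : ℝ) (n : ℕ) : qFact Q x (n + 1) = qFact Q x n * qNum Q (x - n) := by
  simp [qFact, Finset.prod_range_succ]

lemma qFact_mul_qFactorial (Q : ℝ) (z s : ℕ) :
    qFact Q ((s + z : ℕ) : ℝ) s * qFactorial Q z = qFactorial Q (s + z) := by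
  induction s with
  | zero => simp [qFact]
  | succ s ih =>
    rw [show s + 1 + z = s + z + 1 by ring, qFactorial_succ, ← ih, qFact, Finset.prod_range_succ',
      qFact]
    push_cast
    simp only [add_sub_add_right_eq_sub, sub_zero]
    ring

/-- The exponent `∑ⱼ (n - yⱼ)(aⱼ - xⱼ)` of the `q`-Pólya probability function. -/
noncomputable def polyaExponent {k : ℕ} (a : Fin k → ℝ) (n : ℕ) (x : Fin k → ℕ) : ℝ :=
  ∑ j : Fin k, ((n : ℝ) - ∑ i ∈ Finset.univ.filter (fun i : Fin k => (i : ℕ) ≤ (j : ℕ)), (x i : ℝ))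
    * (a j - x j)

/-- The `q`-Pólya weight with arbitrary real parameters, where `z` is the last count. -/
noncomputable def polyaWeight {k : ℕ} (Q : ℝ) (a : Fin k → ℝ) (aLast aTot : ℝ) (n : ℕ)
    (x : Fin k → ℕ) (z : ℕ) : ℝ :=
  qFactorial Q n * Q ^ polyaExponent a n x *
    (∏ j, qFact Q (a j) (x j) / qFactorial Q (x j)) * (qFact Q aLast z / qFactorial Q z) /
    qFact Q aTot n

lemma polyaExponent_succ {k : ℕ} (a : Fin k → ℝ) (n : ℕ) (x : Fin k → ℕ) :
    polyaExponent a (n + 1) x = polyaExponent a n x + ∑ j, (a j - x j) := by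
  rw [polyaExponent, polyaExponent, ← Finset.sum_add_distrib]
  refine Finset.sum_congr rfl fun j _ => ?_
  push_cast
  ring

lemma polyaExponent_succ_update {k : ℕ} (a : Fin k → ℝ) (n : ℕ) (x : Fin k → ℕ) (i : Fin k)
    (s : ℕ) (hs : x i = s + 1) :
    polyaExponent a (n + 1) x +
        ((n + 1 : ℕ) - ∑ l ∈ Finset.univ.filter (fun l : Fin k => (l : ℕ) ≤ (i : ℕ)), (x l : ℝ)) =
      polyaExponent a n (Function.update x i s) +
        ∑ j ∈ Finset.univ.filter (fun j : Fin k => (j : ℕ) < (i : ℕ)), (a j - x j) := by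
  have hpt : ∀ l, (x l : ℝ) = (Function.update x i s l : ℕ) + if i = l then 1 else 0 := by
    intro l
    rcases eq_or_ne i l with rfl | h
    · simp [hs]
    · simp [h, Function.update_of_ne h.symm]
  have hS : ∀ j : Fin k, ∑ l ∈ Finset.univ.filter (fun l : Fin k => (l : ℕ) ≤ (j : ℕ)), (x l : ℝ) =
      ∑ l ∈ Finset.univ.filter (fun l : Fin k => (l : ℕ) ≤ (j : ℕ)),
        ((Function.update x i s l : ℕ) : ℝ) + if (i : ℕ) ≤ j then 1 else 0 := by
    intro j
    rw [Finset.sum_congr rfl fun l _ => hpt l, Finset.sum_add_distrib, Finset.sum_ite_eq]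
    simp
  have hlast : ((n + 1 : ℕ) : ℝ) -
      ∑ l ∈ Finset.univ.filter (fun l : Fin k => (l : ℕ) ≤ (i : ℕ)), (x l : ℝ) =
      ∑ j : Fin k, if i = j then ((n + 1 : ℕ) : ℝ) -
        ∑ l ∈ Finset.univ.filter (fun l : Fin k => (l : ℕ) ≤ (j : ℕ)), (x l : ℝ) else 0 := by
    simp
  rw [hlast, polyaExponent, polyaExponent, Finset.sum_filter, ← Finset.sum_add_distrib,
    ← Finset.sum_add_distrib]
  refine Finset.sum_congr rfl fun j _ => ?_
  rw [hS j]
  generalize ∑ l ∈ Finset.univ.filter (fun l : Fin k => (l : ℕ) ≤ (j : ℕ)),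
        ((Function.update x i s l : ℕ) : ℝ) = S
  rw [hpt j]
  push_cast
  rcases lt_trichotomy i j with h | rfl | h
  · have h1 : (i : ℕ) ≤ j := h.le
    have h2 : ¬ (j : ℕ) < i := not_lt.2 h1
    simp only [h1, h2, h.ne, if_true, if_false]
    ring
  · simp only [le_refl, lt_irrefl, if_true, if_false]
    ring
  · have h1 : (j : ℕ) < i := h
    have h2 : ¬ (i : ℕ) ≤ j := not_le.2 h1
    simp only [h1, h2, h.ne', if_true, if_false]
    ring

lemma polyaWeight_mul_last {k : ℕ} {Q : ℝ} (hQ : 0 < Q) (hQ1 : Q ≠ 1) (a : Fin k → ℝ)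
    (aLast aTot : ℝ) (n : ℕ) (x : Fin k → ℕ) (z : ℕ) :
    polyaWeight Q a aLast aTot n x z *
        (Q ^ (∑ j, (a j - x j)) * qNum Q (aLast - z) / qNum Q (aTot - n)) =
      polyaWeight Q a aLast aTot (n + 1) x (z + 1) * (qNum Q (z + 1) / qNum Q (n + 1)) := by
  have hz : qNum Q ((z : ℝ) + 1) ≠ 0 := qNum_ne_zero hQ hQ1 (by positivity)
  have hn : qNum Q ((n : ℝ) + 1) ≠ 0 := qNum_ne_zero hQ hQ1 (by positivity)
  have hzf := qFactorial_ne_zero_s11 hQ hQ1 z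
  simp only [polyaWeight, qFactorial_succ, qFact_succ, polyaExponent_succ, Real.rpow_add hQ,
    div_eq_mul_inv, mul_inv]
  generalize (qFact Q aTot n)⁻¹ = A
  generalize (qNum Q (aTot - n))⁻¹ = B
  field_simp

lemma polyaWeight_mul_update {k : ℕ} {Q : ℝ} (hQ : 0 < Q) (hQ1 : Q ≠ 1) (a : Fin k → ℝ)
    (aLast aTot : ℝ) (n : ℕ) (x : Fin k → ℕ) (z : ℕ) (i : Fin k) (s : ℕ) (hs : x i = s + 1) :
    polyaWeight Q a aLast aTot n (Function.update x i s) z *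
        (Q ^ (∑ j ∈ Finset.univ.filter (fun j : Fin k => (j : ℕ) < (i : ℕ)), (a j - x j)) *
          qNum Q (a i - s) / qNum Q (aTot - n)) =
      polyaWeight Q a aLast aTot (n + 1) x z *
        (Q ^ (((n + 1 : ℕ) : ℝ) -
            ∑ l ∈ Finset.univ.filter (fun l : Fin k => (l : ℕ) ≤ (i : ℕ)), (x l : ℝ)) *
          qNum Q (x i) / qNum Q (n + 1)) := by
  have hsn : qNum Q ((s : ℝ) + 1) ≠ 0 := qNum_ne_zero hQ hQ1 (by positivity)
  have hn : qNum Q ((n : ℝ) + 1) ≠ 0 := qNum_ne_zero hQ hQ1 (by positivity)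
  have hsf := qFactorial_ne_zero_s11 hQ hQ1 s
  have hE := congrArg (fun t : ℝ => Q ^ t) (polyaExponent_succ_update a n x i s hs)
  simp only [Real.rpow_add hQ] at hE
  have hprod : ∏ j, qFact Q (a j) (Function.update x i s j) /
        qFactorial Q (Function.update x i s j) =
      (qFact Q (a i) s / qFactorial Q s) *
        ∏ j ∈ Finset.univ.erase i, qFact Q (a j) (x j) / qFactorial Q (x j) := by
    rw [← Finset.mul_prod_erase _ _ (Finset.mem_univ i)]
    congr 1
    · simp
    · refine Finset.prod_congr rfl fun j hj => ?_
      rw [Function.update_of_ne (Finset.ne_of_mem_erase hj)]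
  rw [polyaWeight, polyaWeight, hprod, ← Finset.mul_prod_erase _ _ (Finset.mem_univ i), hs]
  simp only [qFactorial_succ, qFact_succ, div_eq_mul_inv, mul_inv]
  push_cast at hE ⊢
  generalize (qFact Q aTot n)⁻¹ = A
  generalize (qNum Q (aTot - n))⁻¹ = B
  generalize ∏ j ∈ Finset.univ.erase i, qFact Q (a j) (x j) * (qFactorial Q (x j))⁻¹ = C
  have key : ∀ u v u' v' c d e f g h t w : ℝ, u * v = u' * v' → c ≠ 0 → d ≠ 0 → e ≠ 0 →
      t * u' * (f * e⁻¹ * C) * w * A * (v' * g * B) =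
      t * c * u * (f * g * (e⁻¹ * d⁻¹) * C) * w * (A * B) * (v * d * c⁻¹) := by
    intro u v u' v' c d e f g h t w huv hc hd he
    field_simp
    linear_combination -(t * w * A * B * g * f * C) * huv
  exact key _ _ _ _ _ _ _ _ _ 0 _ _ hE hn hsn hsf

lemma sum_rpow_mul_qNum_s11 {k : ℕ} {Q : ℝ} (hQ : 0 < Q) (n : ℝ) (x : Fin k → ℕ) :
    qNum Q (n - ∑ j, (x j : ℝ)) + ∑ i : Fin k,
        Q ^ (n - ∑ l ∈ Finset.univ.filter (fun l : Fin k => (l : ℕ) ≤ (i : ℕ)), (x l : ℝ)) *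
          qNum Q (x i) =
      qNum Q n := by
  set T : ℕ → ℝ := fun t => ∑ l ∈ Finset.univ.filter (fun l : Fin k => (l : ℕ) < t), (x l : ℝ)
    with hT
  have hstep : ∀ i : Fin k, T (i + 1) = T i + x i := by
    intro i
    have : Finset.univ.filter (fun l : Fin k => (l : ℕ) < (i : ℕ) + 1) =
        insert i (Finset.univ.filter (fun l : Fin k => (l : ℕ) < (i : ℕ))) := by
      ext l
      simp [Fin.ext_iff]
      omega
    simp only [hT]
    rw [this, Finset.sum_insert (by simp), add_comm]
  have hterm : ∀ i : Fin k,
      Q ^ (n - ∑ l ∈ Finset.univ.filter (fun l : Fin k => (l : ℕ) ≤ (i : ℕ)), (x l : ℝ)) *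
          qNum Q (x i) = (Q ^ (n - T (i + 1)) - Q ^ (n - T i)) / (1 - Q) := by
    intro i
    have h1 : ∑ l ∈ Finset.univ.filter (fun l : Fin k => (l : ℕ) ≤ (i : ℕ)), (x l : ℝ) =
        T (i + 1) := by simp only [hT, Nat.lt_succ_iff]
    rw [h1, show n - T i = n - T (i + 1) + x i by rw [hstep]; ring, Real.rpow_add hQ, qNum]
    ring
  have h0 : T 0 = 0 := by simp [hT]
  have hk : T k = ∑ j, (x j : ℝ) := by simp [hT]
  rw [Finset.sum_congr rfl fun i _ => hterm i,
    Fin.sum_univ_eq_sum_range (fun t => (Q ^ (n - T (t + 1)) - Q ^ (n - T t)) / (1 - Q)),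
    ← Finset.sum_div, Finset.sum_range_sub (fun t => Q ^ (n - T t)), h0, hk, qNum, qNum]
  ring_nf

lemma polyaP_natCast {q : ℝ} {m : ℤ} (hQ : 0 < q ^ (-m)) (hQ1 : q ^ (-m) ≠ 1) {k : ℕ}
    (r : Fin (k + 1) → ℕ) (n : ℕ) (x : Fin k → ℕ) (hx : ∑ j, x j ≤ n) :
    polyaP q m r n (fun j => (x j : ℤ)) =
      polyaWeight (q ^ (-m)) (fun j => -(r j.castSucc : ℝ) / (m : ℝ))
        (-(r (Fin.last k) : ℝ) / (m : ℝ)) (-((∑ j, r j : ℕ) : ℝ) / (m : ℝ)) n x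
        (n - ∑ j, x j) := by
  obtain ⟨z, rfl⟩ := Nat.exists_eq_add_of_le hx
  have hcond : (∀ j, 0 ≤ (x j : ℤ)) ∧ ∑ j, (x j : ℤ) ≤ ((∑ j, x j + z : ℕ) : ℤ) :=
    ⟨fun _ => by positivity, by push_cast; linarith [Int.natCast_nonneg z]⟩
  rw [polyaP, if_pos hcond, polyaWeight, polyaExponent, qMultinom, Finset.prod_div_distrib]
  simp only [Int.toNat_natCast, Nat.add_sub_cancel_left]
  rw [← qFact_mul_qFactorial]
  have hz := qFactorial_ne_zero_s11 hQ hQ1 z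
  have hp : ∏ j, qFactorial (q ^ (-m)) (x j) ≠ 0 :=
    Finset.prod_ne_zero_iff.2 fun j _ => qFactorial_ne_zero_s11 hQ hQ1 _
  congr 1
  field_simp

/-- The `k`-variate `q`-Pólya probability function satisfies `p₀(0,…,0) = 1` and the
total-probability recurrence of Theorem 3.1. -/
theorem multivariate_qPolya_total_probability_recurrence
    (q : ℝ) (hq0 : 0 < q) (hq1 : q ≠ 1)
    (m : ℤ) (hm : m ≠ 0) (k : ℕ) (hk : 1 ≤ k)
    (r : Fin (k + 1) → ℕ) (hrpos : ∀ j, 0 < r j) :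
    polyaP q m r 0 (fun _ => 0) = 1 ∧
    ∀ n : ℕ, 1 ≤ n →
      (∀ i : ℕ, 1 ≤ i → i ≤ n → ((∑ j, r j : ℕ) : ℤ) + m * ((i : ℤ) - 1) ≠ 0) →
      ∀ x : Fin k → ℤ, (∀ j, 0 ≤ x j) → ∑ j, x j ≤ (n : ℤ) →
        polyaP q m r n x =
          polyaP q m r (n - 1) x *
            ((q ^ (-m)) ^
                ((-((∑ i ∈ Finset.univ.filter (fun i : Fin (k + 1) => (i : ℕ) < k), r i : ℕ) : ℝ) /
                    (m : ℝ)) - ((∑ j, x j : ℤ) : ℝ)) *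
              qNum (q ^ (-m))
                (-(r (Fin.last k) : ℝ) / (m : ℝ) - ((n : ℝ) - ((∑ j, x j : ℤ) : ℝ)) + 1) /
              qNum (q ^ (-m)) (-((∑ j, r j : ℕ) : ℝ) / (m : ℝ) - (n : ℝ) + 1)) +
          ∑ i : Fin k,
            polyaP q m r (n - 1) (Function.update x i (x i - 1)) *
              ((q ^ (-m)) ^
                  ((-((∑ jj ∈ Finset.univ.filter (fun jj : Fin (k + 1) => (jj : ℕ) < (i : ℕ)),
                          r jj : ℕ) : ℝ) / (m : ℝ)) -
                    ((∑ jj ∈ Finset.univ.filter (fun jj : Fin k => (jj : ℕ) < (i : ℕ)),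
                        x jj : ℤ) : ℝ)) *
                qNum (q ^ (-m)) (-(r i.castSucc : ℝ) / (m : ℝ) - (x i : ℝ) + 1) /
                qNum (q ^ (-m)) (-((∑ j, r j : ℕ) : ℝ) / (m : ℝ) - (n : ℝ) + 1)) := by
  have hQ : 0 < q ^ (-m) := zpow_pos hq0 _
  have hQ1 : q ^ (-m) ≠ 1 := fun h => by
    exact hm (neg_eq_zero.1 (zpow_right_injective₀ hq0 hq1 (h.trans (zpow_zero q).symm)))
  refine ⟨?_, ?_⟩
  · simp [polyaP, qMultinom, qFact, qFactorial]
  intro n hn _ x hx hxn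
  obtain ⟨n, rfl⟩ : ∃ N, n = N + 1 := ⟨n - 1, by omega⟩
  lift x to Fin k → ℕ using hx
  replace hxn : ∑ j, x j ≤ n + 1 := by
    beta_reduce at hxn
    exact_mod_cast hxn
  rw [Nat.add_sub_cancel]
  have hfilter : ∀ i : ℕ, i ≤ k →
      -((∑ l ∈ Finset.univ.filter (fun l : Fin (k + 1) => (l : ℕ) < i), r l : ℕ) : ℝ) / (m : ℝ) -
        ((∑ l ∈ Finset.univ.filter (fun l : Fin k => (l : ℕ) < i), (x l : ℤ) : ℤ) : ℝ) =
      ∑ l ∈ Finset.univ.filter (fun l : Fin k => (l : ℕ) < i),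
        (-(r l.castSucc : ℝ) / (m : ℝ) - x l) := by
    intro i hi
    rw [Finset.sum_sub_distrib, ← Finset.sum_div, Finset.sum_neg_distrib, Finset.sum_filter,
      Fin.sum_univ_castSucc]
    simp [Finset.sum_filter, not_lt.2 hi]
  have hW := polyaP_natCast hQ hQ1 r (n + 1) x hxn
  have hfull : Finset.univ.filter (fun l : Fin k => (l : ℕ) < k) = Finset.univ := by simp
  have hfilter_k := hfilter k le_rfl
  rw [hfull] at hfilter_k
  have hlast : polyaP q m r n (fun j => (x j : ℤ)) *
      ((q ^ (-m)) ^ ((-((∑ i ∈ Finset.univ.filter (fun i : Fin (k + 1) => (i : ℕ) < k), r i : ℕ) :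
          ℝ) / (m : ℝ)) - ((∑ j, (x j : ℤ) : ℤ) : ℝ)) *
        qNum (q ^ (-m)) (-(r (Fin.last k) : ℝ) / (m : ℝ) -
          (((n + 1 : ℕ) : ℝ) - ((∑ j, (x j : ℤ) : ℤ) : ℝ)) + 1) /
        qNum (q ^ (-m)) (-((∑ j, r j : ℕ) : ℝ) / (m : ℝ) - ((n + 1 : ℕ) : ℝ) + 1)) =
      polyaP q m r (n + 1) (fun j => (x j : ℤ)) *
        (qNum (q ^ (-m)) (((n + 1 : ℕ) : ℝ) - ∑ j, (x j : ℝ)) / qNum (q ^ (-m)) (n + 1)) := by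
    rcases Nat.lt_or_ge n (∑ j, x j) with h | h
    · have heq : ∑ j, x j = n + 1 := by omega
      have h0 : ((n + 1 : ℕ) : ℝ) - ∑ j, (x j : ℝ) = 0 := by
        rw [← heq]
        push_cast
        ring
      have hnot : ¬ ((∀ j, 0 ≤ (x j : ℤ)) ∧ ∑ j, (x j : ℤ) ≤ (n : ℤ)) := by
        rintro ⟨-, h'⟩
        have : ∑ j, x j ≤ n := by exact_mod_cast h'
        omega
      rw [h0, qNum_zero, polyaP, if_neg hnot]
      simp
    · obtain ⟨z, hz⟩ := Nat.exists_eq_add_of_le h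
      have hz1 : n + 1 - ∑ j, x j = z + 1 := by omega
      have hz0 : n - ∑ j, x j = z := by omega
      have hc : (n : ℝ) = ∑ j, (x j : ℝ) + z := by rw [hz]; push_cast; rfl
      rw [hfilter_k, hW, polyaP_natCast hQ hQ1 r n x h, hz1, hz0]
      convert polyaWeight_mul_last hQ hQ1 _ _ _ n x z using 4
      · congr 1
        push_cast
        rw [hc]
        ring
      · push_cast
        ring
      · push_cast
        rw [hc]
        ring
  have hterm : ∀ i : Fin k,
      polyaP q m r n (Function.update (fun j => (x j : ℤ)) i ((x i : ℤ) - 1)) *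
        ((q ^ (-m)) ^
            ((-((∑ jj ∈ Finset.univ.filter (fun jj : Fin (k + 1) => (jj : ℕ) < (i : ℕ)),
                    r jj : ℕ) : ℝ) / (m : ℝ)) -
              ((∑ jj ∈ Finset.univ.filter (fun jj : Fin k => (jj : ℕ) < (i : ℕ)),
                  (x jj : ℤ) : ℤ) : ℝ)) *
          qNum (q ^ (-m)) (-(r i.castSucc : ℝ) / (m : ℝ) - ((x i : ℤ) : ℝ) + 1) /
          qNum (q ^ (-m)) (-((∑ j, r j : ℕ) : ℝ) / (m : ℝ) - ((n + 1 : ℕ) : ℝ) + 1)) =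
      polyaP q m r (n + 1) (fun j => (x j : ℤ)) *
        ((q ^ (-m)) ^ (((n + 1 : ℕ) : ℝ) -
            ∑ l ∈ Finset.univ.filter (fun l : Fin k => (l : ℕ) ≤ (i : ℕ)), (x l : ℝ)) *
          qNum (q ^ (-m)) (x i) / qNum (q ^ (-m)) (n + 1)) := by
    intro i
    rcases Nat.eq_zero_or_pos (x i) with h | h
    · have hnot : ¬ ((∀ j, 0 ≤ Function.update (fun j => (x j : ℤ)) i ((x i : ℤ) - 1) j) ∧
          ∑ j, Function.update (fun j => (x j : ℤ)) i ((x i : ℤ) - 1) j ≤ (n : ℤ)) := by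
        rintro ⟨h', -⟩
        have := h' i
        simp [h] at this
      rw [polyaP, if_neg hnot, h]
      simp [qNum_zero]
    · obtain ⟨s, hs⟩ : ∃ s, x i = s + 1 := ⟨x i - 1, by omega⟩
      have hupd : Function.update (fun j => (x j : ℤ)) i ((x i : ℤ) - 1) =
          fun j => ((Function.update x i s j : ℕ) : ℤ) := by
        funext j
        rcases eq_or_ne j i with rfl | hj
        · simp [hs]
        · simp [Function.update_of_ne hj]
      have hsum : ∑ j, x j = ∑ j, Function.update x i s j + 1 := by
        rw [Finset.sum_update_of_mem (Finset.mem_univ i),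
          ← Finset.add_sum_erase _ _ (Finset.mem_univ i), hs, Finset.sdiff_singleton_eq_erase]
        ring
      have hle : ∑ j, Function.update x i s j ≤ n := by omega
      have hz : n - ∑ j, Function.update x i s j = n + 1 - ∑ j, x j := by omega
      rw [hupd, hfilter i i.isLt.le, hW, polyaP_natCast hQ hQ1 r n _ hle, hz]
      convert polyaWeight_mul_update hQ hQ1 _ _ _ n x _ i s hs using 4
      · rw [hs]
        congr 1
        push_cast
        ring
      · push_cast
        ring
  rw [hlast, Finset.sum_congr rfl fun i _ => hterm i, ← Finset.mul_sum, ← Finset.sum_div,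
    ← mul_add, ← add_div, sum_rpow_mul_qNum_s11 hQ]
  have hne : qNum (q ^ (-m)) ((n : ℝ) + 1) ≠ 0 := qNum_ne_zero hQ hQ1 (by positivity)
  push_cast
  rw [div_self hne, mul_one]
end

section
/- (Limit of the multivariate q-Pólya distribution, case 0 < q < 1.) Let 0 < q < 1, let m be a nonzero integer, let k ≥ 1 and n ≥ 0 be integers, and fix nonnegative integers x_1,…,x_k with y_k ≤ n, where y_j = x_1+⋯+x_j. Let r_1(t),…,r_{k+1}(t) be sequences of positive integers (t ∈ ℕ), put r(t) = Σ_{j=1}^{k+1} r_j(t) and s_j(t) = r_1(t)+⋯+r_j(t) (s_0(t)=0), and assume: (i) r(t) − s_j(t) → ∞ as t → ∞ for each j = 0,1,…,k; (ii) [r(t)−s_j(t)]_{q^{−1}} / [r(t)−s_{j−1}(t)]_{q^{−1}} → θ_j as t → ∞, for j = 1,…,k, where either m > 0 and 0 < θ_j < 1 for all j, or m < 0 and 0 < θ_j < q^{−m(n−1)} for all j. Then the k-variate q-Pólya probability function p_n(x_1,…,x_k) built from (r_1(t),…,r_{k+1}(t)), m, q converges, as t → ∞, to [n; x_1,…,x_k]_{q^m}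 · ∏_{j=1}^{k} θ_j^{n−y_j} · ∏_{i=1}^{x_j}(1 − θ_j q^{m(i−1)}). -/
open Finset Filter

theorem qNum_inv {p : ℝ} (hp : 0 < p) (hp1 : p ≠ 1) (a : ℝ) :
    qNum p⁻¹ a = p ^ (1 - a) * qNum p a := by
  have h1 : (1 : ℝ) - p ≠ 0 := sub_ne_zero.mpr hp1.symm
  have h2 : (1 : ℝ) - p⁻¹ ≠ 0 := sub_ne_zero.mpr fun h => hp1 (by simpa using h.symm)
  have h3 : p ^ a ≠ 0 := (Real.rpow_pos_of_pos hp a).ne'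
  have h4 : p - 1 ≠ 0 := sub_ne_zero.mpr hp1
  rw [qNum, qNum, Real.inv_rpow hp.le, Real.rpow_sub hp, Real.rpow_one, ← mul_div_assoc,
    div_eq_div_iff h2 h1]
  field_simp
  ring

theorem qNum_natCast_ne_zero {p : ℝ} (hp : 0 < p) (hp1 : p ≠ 1) {a : ℕ} (ha : a ≠ 0) :
    qNum p a ≠ 0 := by
  rw [qNum, Real.rpow_natCast]
  refine div_ne_zero (sub_ne_zero.mpr fun h => hp1 ?_) (sub_ne_zero.mpr hp1.symm)
  exact (pow_eq_one_iff_of_nonneg hp.le ha).mp h.symm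

theorem qFactorial_ne_zero_s14 {p : ℝ} (hp : 0 < p) (hp1 : p ≠ 1) (r : ℕ) : qFactorial p r ≠ 0 := by
  refine Finset.prod_ne_zero_iff.mpr fun i _ => ?_
  exact_mod_cast qNum_natCast_ne_zero hp hp1 i.succ_ne_zero

theorem qFact_inv {p : ℝ} (hp : 0 < p) (hp1 : p ≠ 1) (a : ℝ) (r : ℕ) :
    qFact p⁻¹ a r = p ^ (r * (1 - a) + r * (r - 1) / 2 : ℝ) * qFact p a r := by
  induction r with
  | zero => simp [qFact]
  | succ r ih =>
    have h : ((r + 1 : ℕ) * (1 - a) + (r + 1 : ℕ) * ((r + 1 : ℕ) - 1) / 2 : ℝ)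
        = (r * (1 - a) + r * (r - 1) / 2) + (1 - (a - r)) := by push_cast; ring
    rw [h, Real.rpow_add hp, qFact, Finset.prod_range_succ, ← qFact, ih, qNum_inv hp hp1,
      qFact, qFact, Finset.prod_range_succ]
    ring

theorem qFactorial_inv {p : ℝ} (hp : 0 < p) (hp1 : p ≠ 1) (r : ℕ) :
    qFactorial p⁻¹ r = p ^ (-(r * (r - 1) / 2) : ℝ) * qFactorial p r := by
  induction r with
  | zero => simp [qFactorial]
  | succ r ih =>
    have h : (-((r + 1 : ℕ) * ((r + 1 : ℕ) - 1) / 2) : ℝ)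
        = -(r * (r - 1) / 2) + (1 - (r + 1)) := by push_cast; ring
    rw [h, Real.rpow_add hp, qFactorial, Finset.prod_range_succ, ← qFactorial, ih,
      qNum_inv hp hp1, qFactorial, qFactorial, Finset.prod_range_succ]
    ring

theorem two_mul_sum_partial_sum_mul {k : ℕ} (f : Fin k → ℝ) :
    2 * ∑ j : Fin k, (∑ i ∈ Finset.univ.filter (fun i : Fin k => (i : ℕ) ≤ (j : ℕ)), f i) * f j
      = (∑ j, f j) ^ 2 + ∑ j, f j ^ 2 := by
  have h1 : ∑ j : Fin k, (∑ i ∈ Finset.univ.filter (fun i : Fin k => (i : ℕ) ≤ (j : ℕ)), f i) * f j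
      = ∑ j : Fin k, ∑ i : Fin k, if (i : ℕ) ≤ (j : ℕ) then f i * f j else 0 := by
    simp_rw [Finset.sum_mul, Finset.sum_filter]
  have h2 : ∑ j, f j ^ 2 = ∑ j, ∑ i, if i = j then f i * f j else 0 := by
    simp [sq]
  rw [two_mul, h1]
  nth_rewrite 1 [Finset.sum_comm]
  rw [h2, sq, Finset.sum_mul_sum, ← Finset.sum_add_distrib, ← Finset.sum_add_distrib]
  refine Finset.sum_congr rfl fun j _ => ?_
  rw [← Finset.sum_add_distrib, ← Finset.sum_add_distrib]
  refine Finset.sum_congr rfl fun i _ => ?_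
  rcases lt_trichotomy i j with h | h | h
  · have h' : (i : ℕ) < j := h
    simp [h.ne, h'.le, h'.not_ge, mul_comm]
  · subst h
    simp
  · have h' : (j : ℕ) < i := h
    simp [h.ne', h'.le, h'.not_ge]

/-- Inversion of the base of a `q`-multinomial coefficient. -/
theorem qMultinom_inv {p : ℝ} (hp : 0 < p) (hp1 : p ≠ 1) {k : ℕ} (a : ℝ) (x : Fin k → ℕ) :
    qMultinom p⁻¹ a x = p ^ (-∑ j : Fin k,
      (a - ∑ i ∈ Finset.univ.filter (fun i : Fin k => (i : ℕ) ≤ (j : ℕ)), (x i : ℝ)) * x j) *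
        qMultinom p a x := by
  have h := two_mul_sum_partial_sum_mul (fun j => (x j : ℝ))
  have hne : ∏ j, qFactorial p (x j) ≠ 0 :=
    Finset.prod_ne_zero_iff.mpr fun j _ => qFactorial_ne_zero_s14 hp hp1 _
  simp_rw [qMultinom, qFact_inv hp hp1, qFactorial_inv hp hp1, Finset.prod_mul_distrib,
    ← Real.rpow_sum_of_pos hp]
  rw [mul_div_mul_comm, ← Real.rpow_sub hp]
  congr 2
  simp_rw [sub_mul, mul_sub, Finset.sum_sub_distrib, Finset.sum_neg_distrib, ← Finset.sum_div,
    Finset.sum_sub_distrib, ← Finset.mul_sum, mul_one, ← sq]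
  push_cast
  linarith

theorem sum_filter_val_lt_succ {N : ℕ} (f : Fin N → ℕ) (c : Fin N) :
    ∑ i ∈ Finset.univ.filter (fun i : Fin N => (i : ℕ) < (c : ℕ) + 1), f i
      = (∑ i ∈ Finset.univ.filter (fun i : Fin N => (i : ℕ) < (c : ℕ)), f i) + f c := by
  have h : Finset.univ.filter (fun i : Fin N => (i : ℕ) < (c : ℕ) + 1)
      = insert c (Finset.univ.filter (fun i : Fin N => (i : ℕ) < (c : ℕ))) := by
    ext i
    simp [Fin.ext_iff]
    omega
  rw [h, Finset.sum_insert (by simp), add_comm]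

/-- If `B → ∞` and `[B]_{q⁻¹} / [B + r]_{q⁻¹} → θ`, then `q ^ r → θ`. -/
theorem tendsto_pow_of_tendsto_qNum_ratio {q θ : ℝ} (hq0 : 0 < q) (hq1 : q < 1) {B r : ℕ → ℕ}
    (hB : Tendsto B atTop atTop)
    (h : Tendsto (fun t => qNum q⁻¹ (B t : ℝ) / qNum q⁻¹ ((B t + r t : ℕ) : ℝ)) atTop (nhds θ)) :
    Tendsto (fun t => q ^ r t) atTop (nhds θ) := by
  have hpow := tendsto_pow_atTop_nhds_zero_of_lt_one hq0.le hq1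
  have hB0 := hpow.comp hB
  have hA0 := hpow.comp (tendsto_atTop_mono (fun t => Nat.le_add_right (B t) (r t)) hB)
  have hlim := h.mul ((hA0.const_sub 1).div (hB0.const_sub 1) (by norm_num))
  rw [sub_zero, div_one, mul_one] at hlim
  refine hlim.congr' ?_
  filter_upwards [hB.eventually_ge_atTop 1] with t ht
  have h1 : (1 : ℝ) - q ≠ 0 := by linarith
  have hB1 : 1 - q ^ B t ≠ 0 := by
    have := pow_lt_one₀ hq0.le hq1 (show B t ≠ 0 by omega)
    linarith
  have hA1 : 1 - q ^ (B t + r t) ≠ 0 := by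
    have := pow_lt_one₀ hq0.le hq1 (show B t + r t ≠ 0 by omega)
    linarith
  have hexp : q ^ (1 - (B t : ℝ)) = q ^ (1 - ((B t + r t : ℕ) : ℝ)) * q ^ r t := by
    rw [← Real.rpow_natCast q (r t), ← Real.rpow_add hq0]
    congr 1
    push_cast
    ring
  have hne := (Real.rpow_pos_of_pos hq0 (1 - ((B t + r t : ℕ) : ℝ))).ne'
  rw [qNum_inv hq0 hq1.ne, qNum_inv hq0 hq1.ne, hexp]
  simp only [qNum, Real.rpow_natCast, Function.comp, Pi.div_apply]
  field_simp

theorem zpow_neg_rpow_div {q : ℝ} (hq0 : 0 < q) {m : ℤ} (hm : m ≠ 0) (a b : ℝ) :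
    (q ^ (-m)) ^ (-a / (m : ℝ) - b) = q ^ a * (q ^ m) ^ b := by
  have hm' : (m : ℝ) ≠ 0 := Int.cast_ne_zero.mpr hm
  rw [← Real.rpow_intCast, ← Real.rpow_intCast, ← Real.rpow_mul hq0.le, ← Real.rpow_mul hq0.le,
    ← Real.rpow_add hq0]
  congr 1
  push_cast
  field_simp
  ring

theorem qFact_zpow_neg {q : ℝ} (hq0 : 0 < q) {m : ℤ} (hm : m ≠ 0) (r s : ℕ) :
    qFact (q ^ (-m)) (-(r : ℝ) / (m : ℝ)) s
      = (∏ i ∈ Finset.range s, (1 - q ^ r * q ^ (m * (i : ℤ)))) / (1 - q ^ (-m)) ^ s := by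
  simp_rw [qFact, qNum, zpow_neg_rpow_div hq0 hm, Real.rpow_natCast, Finset.prod_div_distrib,
    Finset.prod_const, Finset.card_range, zpow_mul, zpow_natCast]

theorem tendsto_qFact_zpow_neg {q θ : ℝ} (hq0 : 0 < q) {m : ℤ} (hm : m ≠ 0) {r : ℕ → ℕ}
    (h : Tendsto (fun t => q ^ r t) atTop (nhds θ)) (s : ℕ) :
    Tendsto (fun t => qFact (q ^ (-m)) (-(r t : ℝ) / (m : ℝ)) s) atTop
      (nhds ((∏ i ∈ Finset.range s, (1 - θ * q ^ (m * (i : ℤ)))) / (1 - q ^ (-m)) ^ s)) := by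
  simp_rw [qFact_zpow_neg hq0 hm]
  exact (tendsto_finsetProd _ fun i _ => (h.mul_const _).const_sub 1).div_const _

/-- The power of `Q = q ^ (-m)` occurring in the `q`-Pólya probability function. -/
theorem zpow_neg_rpow_sum {q : ℝ} (hq0 : 0 < q) {m : ℤ} (hm : m ≠ 0) {ι : Type*} [Fintype ι]
    (r e : ι → ℕ) (b : ι → ℝ) :
    (q ^ (-m)) ^ (∑ j, (e j : ℝ) * (-(r j : ℝ) / (m : ℝ) - b j))
      = (∏ j, (q ^ r j) ^ e j) * (q ^ m) ^ (∑ j, (e j : ℝ) * b j) := by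
  rw [Real.rpow_sum_of_pos (zpow_pos hq0 _), Real.rpow_sum_of_pos (zpow_pos hq0 _),
    ← Finset.prod_mul_distrib]
  refine Finset.prod_congr rfl fun j _ => ?_
  rw [mul_comm, Real.rpow_mul (zpow_pos hq0 _).le, zpow_neg_rpow_div hq0 hm, Real.rpow_natCast,
    Real.rpow_natCast, mul_pow, mul_comm (e j : ℝ), Real.rpow_mul (zpow_pos hq0 _).le,
    Real.rpow_natCast]

/-- Limit of the multivariate `q`-Pólya distribution for `0 < q < 1` (Theorem 3.3,
first case): if `r(t) − s_j(t) → ∞` and `[r(t)−s_j(t)]_{q⁻¹}/[r(t)−s_{j−1}(t)]_{q⁻¹} → θ_j`,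
then `p_n(x₁,…,x_k) → [n; x₁,…,x_k]_{q^m} ∏_{j=1}^{k} θ_j^{n−y_j} ∏_{i=1}^{x_j}(1−θ_j q^{m(i−1)})`,
a `q`-multinomial distribution of the second kind. -/
theorem multivariate_qPolya_limit_q_lt_one
    (q : ℝ) (hq0 : 0 < q) (hq1 : q < 1)
    (m : ℤ) (hm : m ≠ 0) (k n : ℕ) (hk : 1 ≤ k)
    (x : Fin k → ℕ) (hx : ∑ j, x j ≤ n)
    (r : ℕ → Fin (k + 1) → ℕ) (hrpos : ∀ t j, 0 < r t j)
    (θ : Fin k → ℝ)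
    (hinf : ∀ jv : ℕ, jv ≤ k →
      Filter.Tendsto
        (fun t => (∑ j, r t j) -
          ∑ i ∈ Finset.univ.filter (fun i : Fin (k + 1) => (i : ℕ) < jv), r t i)
        Filter.atTop Filter.atTop)
    (hθ : ∀ j : Fin k,
      Filter.Tendsto
        (fun t =>
          qNum q⁻¹ ((((∑ i, r t i) -
              ∑ i ∈ Finset.univ.filter (fun i : Fin (k + 1) => (i : ℕ) < (j : ℕ) + 1),
                r t i : ℕ) : ℝ)) /
          qNum q⁻¹ ((((∑ i, r t i) -
              ∑ i ∈ Finset.univ.filter (fun i : Fin (k + 1) => (i : ℕ) < (j : ℕ)),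
                r t i : ℕ) : ℝ)))
        Filter.atTop (nhds (θ j)))
    (hθrange : (0 < m ∧ ∀ j, 0 < θ j ∧ θ j < 1) ∨
        (m < 0 ∧ ∀ j, 0 < θ j ∧ θ j < q ^ (-m * ((n : ℤ) - 1)))) :
    Filter.Tendsto
      (fun t =>
        qMultinom (q ^ (-m)) (n : ℝ) x *
          (q ^ (-m)) ^ (∑ j : Fin k,
              ((n : ℝ) -
                  ∑ i ∈ Finset.univ.filter (fun i : Fin k => (i : ℕ) ≤ (j : ℕ)), (x i : ℝ)) *
                (-(r t j.castSucc : ℝ) / (m : ℝ) - x j)) *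
          ((∏ j : Fin k, qFact (q ^ (-m)) (-(r t j.castSucc : ℝ) / (m : ℝ)) (x j)) *
            qFact (q ^ (-m)) (-(r t (Fin.last k) : ℝ) / (m : ℝ)) (n - ∑ i, x i)) /
          qFact (q ^ (-m)) (-((∑ j, r t j : ℕ) : ℝ) / (m : ℝ)) n)
      Filter.atTop
      (nhds (qMultinom (q ^ m) (n : ℝ) x *
        ∏ j : Fin k,
          θ j ^ (n - ∑ i ∈ Finset.univ.filter (fun i : Fin k => (i : ℕ) ≤ (j : ℕ)), x i) *
            ∏ i ∈ Finset.range (x j), (1 - θ j * q ^ (m * (i : ℤ))))) := by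
  have hpow := tendsto_pow_atTop_nhds_zero_of_lt_one hq0.le hq1
  have hp : 0 < q ^ m := zpow_pos hq0 m
  have hp1 : q ^ m ≠ 1 := fun h => hm ((zpow_eq_one_iff_right₀ hq0.le hq1.ne).mp h)
  have hQ : (1 : ℝ) - q ^ (-m) ≠ 0 := by
    rw [zpow_neg]
    exact sub_ne_zero.mpr fun h => hp1 (by simpa using h.symm)
  have hrj : ∀ j : Fin k, Tendsto (fun t => q ^ r t j.castSucc) atTop (nhds (θ j)) := by
    intro j
    refine tendsto_pow_of_tendsto_qNum_ratio hq0 hq1 (hinf (j + 1) j.isLt) ((hθ j).congr fun t => ?_)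
    have h := sum_filter_val_lt_succ (r t) j.castSucc
    have hle := Finset.sum_le_sum_of_subset (f := r t) (Finset.filter_subset
      (fun i : Fin (k + 1) => (i : ℕ) < (j : ℕ) + 1) Finset.univ)
    simp only [Fin.val_castSucc] at h
    congr 3
    omega
  have hlast : Tendsto (fun t => q ^ r t (Fin.last k)) atTop (nhds 0) := by
    refine (hpow.comp (hinf k le_rfl)).congr fun t => ?_
    have h := sum_filter_val_lt_succ (r t) (Fin.last k)
    simp only [Fin.val_last, Fin.is_lt, Finset.filter_true] at h
    simp only [Function.comp]
    congr 1
    omega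
  have htot : Tendsto (fun t => q ^ ∑ j, r t j) atTop (nhds 0) := by
    simpa [Function.comp_def] using hpow.comp (hinf 0 (Nat.zero_le k))
  have hden := tendsto_qFact_zpow_neg hq0 hm htot n
  have hnum := (tendsto_finsetProd Finset.univ fun j _ =>
    tendsto_qFact_zpow_neg hq0 hm (hrj j) (x j)).mul
      (tendsto_qFact_zpow_neg hq0 hm hlast (n - ∑ i, x i))
  simp only [zero_mul, sub_zero, Finset.prod_const_one] at hden hnum
  have hy : ∀ j : Fin k,
      ∑ i ∈ Finset.univ.filter (fun i : Fin k => (i : ℕ) ≤ (j : ℕ)), x i ≤ n :=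
    fun j => (Finset.sum_le_sum_of_subset (Finset.filter_subset _ _)).trans hx
  have hexp : ∀ j : Fin k, (n : ℝ) -
      ∑ i ∈ Finset.univ.filter (fun i : Fin k => (i : ℕ) ≤ (j : ℕ)), (x i : ℝ)
      = ((n - ∑ i ∈ Finset.univ.filter (fun i : Fin k => (i : ℕ) ≤ (j : ℕ)), x i : ℕ) : ℝ) := by
    intro j
    rw [Nat.cast_sub (hy j), Nat.cast_sum]
  have hmult := qMultinom_inv hp hp1 (n : ℝ) x
  rw [← zpow_neg] at hmult
  simp_rw [hexp] at hmult ⊢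
  simp_rw [hmult, zpow_neg_rpow_sum hq0 hm]
  have hmain := (((tendsto_finsetProd Finset.univ fun j _ => (hrj j).pow
    (n - ∑ i ∈ Finset.univ.filter (fun i : Fin k => (i : ℕ) ≤ (j : ℕ)), x i)).mul_const
      ((q ^ m) ^ (∑ j : Fin k, ((n - ∑ i ∈ Finset.univ.filter
        (fun i : Fin k => (i : ℕ) ≤ (j : ℕ)), x i : ℕ) : ℝ) * (x j : ℝ)))).const_mul
          ((q ^ m) ^ (-∑ j : Fin k, ((n - ∑ i ∈ Finset.univ.filter
            (fun i : Fin k => (i : ℕ) ≤ (j : ℕ)), x i : ℕ) : ℝ) * (x j : ℝ)) *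
              qMultinom (q ^ m) (n : ℝ) x)).mul hnum
  convert hmain.div hden (one_div_ne_zero (pow_ne_zero _ hQ)) using 2
  · rfl
  rw [Finset.prod_mul_distrib, Finset.prod_div_distrib, Finset.prod_pow_eq_pow_sum,
    Real.rpow_neg hp.le]
  have hS := (Real.rpow_pos_of_pos hp (∑ j : Fin k, ((n - ∑ i ∈ Finset.univ.filter
    (fun i : Fin k => (i : ℕ) ≤ (j : ℕ)), x i : ℕ) : ℝ) * (x j : ℝ))).ne'
  have hsplit : (1 - q ^ (-m)) ^ n
      = (1 - q ^ (-m)) ^ (∑ i, x i) * (1 - q ^ (-m)) ^ (n - ∑ i, x i) := by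
    rw [← pow_add, Nat.add_sub_cancel' hx]
  rw [hsplit]
  have h1 := pow_ne_zero (∑ i, x i) hQ
  have h2 := pow_ne_zero (n - ∑ i, x i) hQ
  generalize (1 - q ^ (-m)) ^ (∑ i, x i) = u at *
  generalize (1 - q ^ (-m)) ^ (n - ∑ i, x i) = v at *
  field_simp
end

section
/- (Conditioning independent q-binomial variables gives the multivariate q-hypergeometric distribution.) Let k ≥ 1, let θ > 0 and q > 0 real with q ≠ 1, let r_1,…,r_{k+1} be nonnegative integers with r = r_1+⋯+r_{k+1}, and set s_0 = 0, s_j = r_1+⋯+r_j. For integers 0 ≤ x_j ≤ r_j define f_j(x_j) = [r_j; x_j]_q · (θ q^{s_{j−1}})^{x_j} · q^{C(x_j,2)} / ∏_{i=1}^{r_j}(1 + θ q^{s_{j−1}+i−1}), and for 0 ≤ n ≤ r define g(n) = [r; n]_q · θ^n · q^{C(n,2)} / ∏_{i=1}^{r}(1 + θ q^{i−1}), where C(a,2) = a(a−1)/2. Then for all nonnegative integers x_1,…,x_{k+1} with x_j ≤ r_j for each j and x_1+⋯+x_{k+1} = n, one has (∏_{j=1}^{k+1} f_j(x_j)) / g(n)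 = q^{Σ_{j=1}^{k}(n−y_j)(r_j−x_j)} · (∏_{j=1}^{k+1}[r_j; x_j]_q) / [r; n]_q, where y_j = x_1+⋯+x_j. -/
open Finset Filter

theorem sum_filter_val_lt_castSucc {m : ℕ} (r : Fin (m + 1) → ℕ) (j : Fin m) :
    ∑ i ∈ Finset.univ.filter (fun i : Fin (m + 1) => (i : ℕ) < (j.castSucc : ℕ)), r i =
      ∑ i ∈ Finset.univ.filter (fun i : Fin m => (i : ℕ) < (j : ℕ)), r i.castSucc := by
  have h : ¬ m < (j : ℕ) := by have := j.isLt; omega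
  simp [Finset.sum_filter, Fin.sum_univ_castSucc, h]

theorem sum_filter_val_le_castSucc {m : ℕ} (r : Fin (m + 1) → ℕ) (j : Fin m) :
    ∑ i ∈ Finset.univ.filter (fun i : Fin (m + 1) => (i : ℕ) ≤ (j : ℕ)), r i =
      ∑ i ∈ Finset.univ.filter (fun i : Fin m => (i : ℕ) ≤ (j : ℕ)), r i.castSucc := by
  have h : ¬ m ≤ (j : ℕ) := by have := j.isLt; omega
  simp [Finset.sum_filter, Fin.sum_univ_castSucc, h]

theorem sum_filter_val_lt_last {m : ℕ} (r : Fin (m + 1) → ℕ) :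
    ∑ i ∈ Finset.univ.filter (fun i : Fin (m + 1) => (i : ℕ) < (Fin.last m : ℕ)), r i =
      ∑ i : Fin m, r i.castSucc := by
  simp [Finset.sum_filter, Fin.sum_univ_castSucc]

theorem sum_filter_val_le_last {m : ℕ} (r : Fin (m + 1) → ℕ) :
    ∑ i ∈ Finset.univ.filter (fun i : Fin (m + 1) => (i : ℕ) ≤ (Fin.last m : ℕ)), r i =
      ∑ i, r i :=
  congrArg (fun s => ∑ i ∈ s, r i) (Finset.filter_true_of_mem fun i _ => Fin.le_last i)

/-- A product over consecutive blocks of lengths `r j` is a product over one range. -/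
theorem prod_prod_range_partialSum {M : Type*} [CommMonoid M] (f : ℕ → M) {m : ℕ}
    (r : Fin m → ℕ) :
    ∏ j : Fin m, ∏ i ∈ Finset.range (r j),
        f ((∑ i' ∈ Finset.univ.filter (fun i' : Fin m => (i' : ℕ) < (j : ℕ)), r i') + i) =
      ∏ i ∈ Finset.range (∑ j, r j), f i := by
  induction m with
  | zero => simp
  | succ m ih =>
    rw [Fin.prod_univ_castSucc, Fin.sum_univ_castSucc, Finset.prod_range_add]
    simp only [sum_filter_val_lt_castSucc, sum_filter_val_lt_last, ih (fun i => r i.castSucc)]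

theorem choose_two_add (a b : ℕ) :
    (a + b).choose 2 = a.choose 2 + b.choose 2 + a * b := by
  induction b with
  | zero => simp
  | succ b ih =>
    rw [← Nat.add_assoc, Nat.choose_succ_succ' (a + b) 1, Nat.choose_succ_succ' b 1, ih]
    simp only [Nat.choose_one_right]
    ring

/-- The exponents of `q` on both sides of the conditioning identity agree. -/
theorem sum_partialSum_mul_add_sum_choose_two {m : ℕ} (r x : Fin m → ℕ)
    (hxr : ∀ j, x j ≤ r j) :
    ∑ j : Fin m,
        (∑ i ∈ Finset.univ.filter (fun i : Fin m => (i : ℕ) < (j : ℕ)), r i) * x j +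
        ∑ j, (x j).choose 2 =
      (∑ j, x j).choose 2 +
        ∑ j : Fin m,
          (∑ i, x i - ∑ i ∈ Finset.univ.filter (fun i : Fin m => (i : ℕ) ≤ (j : ℕ)), x i) *
            (r j - x j) := by
  induction m with
  | zero => simp
  | succ m ih =>
    have hshift : ∀ j : Fin m,
        (∑ i : Fin m, x i.castSucc + x (Fin.last m) -
            ∑ i ∈ Finset.univ.filter (fun i : Fin m => (i : ℕ) ≤ (j : ℕ)), x i.castSucc) *
          (r j.castSucc - x j.castSucc) =
        (∑ i : Fin m, x i.castSucc -
            ∑ i ∈ Finset.univ.filter (fun i : Fin m => (i : ℕ) ≤ (j : ℕ)), x i.castSucc) *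
          (r j.castSucc - x j.castSucc) +
        x (Fin.last m) * (r j.castSucc - x j.castSucc) := by
      intro j
      have hle : ∑ i ∈ Finset.univ.filter (fun i : Fin m => (i : ℕ) ≤ (j : ℕ)), x i.castSucc ≤
          ∑ i : Fin m, x i.castSucc :=
        Finset.sum_le_sum_of_subset (Finset.filter_subset _ _)
      rw [Nat.sub_add_comm hle, Nat.add_mul]
    have hr : ∑ j : Fin m, r j.castSucc =
        ∑ j : Fin m, (r j.castSucc - x j.castSucc) + ∑ j : Fin m, x j.castSucc := by
      rw [← Finset.sum_add_distrib]
      exact Finset.sum_congr rfl fun j _ => (Nat.sub_add_cancel (hxr _)).symm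
    have ih' := ih (fun i => r i.castSucc) (fun i => x i.castSucc) fun j => hxr _
    simp only [Fin.sum_univ_castSucc (n := m) (f := fun j => _ * x j),
      Fin.sum_univ_castSucc (n := m) (f := fun j => (x j).choose 2),
      Fin.sum_univ_castSucc (n := m) (f := fun j => _ * (r j - x j)), sum_filter_val_le_last,
      Nat.sub_self, Nat.zero_mul, Nat.add_zero, sum_filter_val_lt_castSucc,
      sum_filter_val_lt_last]
    simp only [Fin.val_castSucc, sum_filter_val_le_castSucc, Fin.sum_univ_castSucc (f := x),
      hshift, Finset.sum_add_distrib, ← Finset.mul_sum, choose_two_add]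
    rw [hr]
    linarith

/-- Conditioning independent `q`-binomial random variables on their sum yields the
multivariate `q`-hypergeometric distribution (Theorem 3.4):
`(∏_{j=1}^{k+1} f_j(x_j)) / g(n) = q^{∑_{j=1}^{k}(n−y_j)(r_j−x_j)} (∏_{j=1}^{k+1}[r_j; x_j]_q)/[r; n]_q`. -/
theorem qBinomial_conditional_multivariate_qHypergeometric
    (k : ℕ) (hk : 1 ≤ k) (θ q : ℝ) (hθ : 0 < θ) (hq0 : 0 < q) (hq1 : q ≠ 1)
    (r x : Fin (k + 1) → ℕ) (hxr : ∀ j, x j ≤ r j) (n : ℕ) (hn : ∑ j, x j = n) :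
    (∏ j : Fin (k + 1),
        qBinom q (r j : ℝ) (x j) *
          (θ * q ^ (∑ i ∈ Finset.univ.filter (fun i : Fin (k + 1) => (i : ℕ) < (j : ℕ)), r i)) ^
            (x j) *
          q ^ (Nat.choose (x j) 2) /
          ∏ i ∈ Finset.range (r j),
            (1 + θ *
              q ^ ((∑ i' ∈ Finset.univ.filter (fun i' : Fin (k + 1) => (i' : ℕ) < (j : ℕ)), r i') +
                i))) /
      (qBinom q ((∑ j, r j : ℕ) : ℝ) n * θ ^ n * q ^ (Nat.choose n 2) /
        ∏ i ∈ Finset.range (∑ j, r j), (1 + θ * q ^ i)) =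
    q ^ (∑ j : Fin k,
          (n - ∑ i ∈ Finset.univ.filter (fun i : Fin (k + 1) => (i : ℕ) ≤ (j : ℕ)), x i) *
            (r j.castSucc - x j.castSucc)) *
      (∏ j : Fin (k + 1), qBinom q (r j : ℝ) (x j)) /
      qBinom q ((∑ j, r j : ℕ) : ℝ) n := by
  have hexp := sum_partialSum_mul_add_sum_choose_two r x hxr
  rw [Fin.sum_univ_castSucc (f := fun j => _ * (r j - x j)),
    sum_filter_val_le_last, Nat.sub_self, Nat.zero_mul, hn] at hexp
  simp only [Fin.val_castSucc, Nat.add_zero] at hexp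
  have hden : ∏ i ∈ Finset.range (∑ j, r j), (1 + θ * q ^ i) ≠ 0 :=
    Finset.prod_ne_zero_iff.mpr fun i _ => by positivity
  rw [Finset.prod_div_distrib, prod_prod_range_partialSum (fun i => 1 + θ * q ^ i) r,
    div_div_div_cancel_right₀ hden]
  simp only [mul_pow, ← pow_mul, Finset.prod_mul_distrib, Finset.prod_pow_eq_pow_sum]
  rw [hn, mul_assoc (qBinom _ _ _), ← mul_div_mul_right
    (q ^ _ * ∏ j : Fin (k + 1), qBinom q (r j : ℝ) (x j)) _
    (show θ ^ n * q ^ Nat.choose n 2 ≠ 0 by positivity)]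
  congr 1
  have hpow := congrArg (fun e => q ^ e) hexp
  simp only [pow_add] at hpow
  linear_combination (∏ j : Fin (k + 1), qBinom q (r j : ℝ) (x j)) * θ ^ n * hpow
end

section
/- (Conditioning independent negative q-binomial variables gives the multivariate negative q-hypergeometric distribution.) Let k ≥ 1, let q > 0 real with q ≠ 1 and 0 < θ < 1; let r_1,…,r_{k+1} be nonnegative integers with r = r_1+⋯+r_{k+1} and s_0 = 0, s_j = r_1+⋯+r_j; if q > 1 assume additionally θ q^{r−1} < 1. For a nonnegative integer w define f_j(w) = [r_j+w−1; w]_q · (θ q^{s_{j−1}})^{w} · ∏_{i=1}^{r_j}(1 − θ q^{s_{j−1}+i−1}), and for a nonnegative integer n define g(n) = [r+n−1; n]_q · θ^n · ∏_{i=1}^{r}(1 − θ q^{i−1}). Then for all nonnegative integers w_1,…,w_{k+1} with w_1+⋯+w_{k+1} = n, one has (∏_{j=1}^{k+1} f_j(w_j)) / g(n) = q^{Σ_{j=1}^{k} r_j(n−u_j)} · (∏_{j=1}^{k+1}[r_j+w_j−1; w_j]_q) / [r+n−1; n]_q, where u_j = w_1+⋯+w_j. -/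
open Finset Filter

theorem prod_range_partial_sums {M : Type*} [CommMonoid M] (f : ℕ → M) (m : ℕ) (r : Fin m → ℕ) :
    ∏ j : Fin m, ∏ i ∈ range (r j),
        f ((∑ i' ∈ univ.filter (fun i' : Fin m => (i' : ℕ) < (j : ℕ)), r i') + i) =
      ∏ i ∈ range (∑ j, r j), f i := by
  induction m with
  | zero => simp
  | succ m ih =>
    rw [Fin.prod_univ_castSucc, Fin.sum_univ_castSucc, prod_range_add,
      ← ih (fun j => r j.castSucc)]
    congr 1
    · refine prod_congr rfl fun j _ => ?_
      have h : ¬ m < (j : ℕ) := by omega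
      simp [sum_filter, Fin.sum_univ_castSucc, h]
    · simp [sum_filter, Fin.sum_univ_castSucc]

theorem sum_mul_sub_partial_sums (k : ℕ) (r w : Fin (k + 1) → ℕ) :
    ∑ j : Fin k, r j.castSucc *
        ((∑ i, w i) - ∑ i ∈ univ.filter (fun i : Fin (k + 1) => (i : ℕ) ≤ (j : ℕ)), w i) =
      ∑ j : Fin (k + 1),
        (∑ i ∈ univ.filter (fun i : Fin (k + 1) => (i : ℕ) < (j : ℕ)), r i) * w j := by
  have tail (j : Fin (k + 1)) :
      (∑ i, w i) - ∑ i ∈ univ.filter (fun i : Fin (k + 1) => (i : ℕ) ≤ (j : ℕ)), w i =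
        ∑ i : Fin (k + 1), if (j : ℕ) < (i : ℕ) then w i else 0 := by
    rw [← sum_filter_add_sum_filter_not univ (fun i : Fin (k + 1) => (i : ℕ) ≤ (j : ℕ)) w,
      Nat.add_sub_cancel_left]
    simp only [not_le, sum_filter]
  have last_term : (∑ i, w i) -
      ∑ i ∈ univ.filter (fun i : Fin (k + 1) => (i : ℕ) ≤ (Fin.last k : ℕ)), w i = 0 := by
    rw [tail]
    refine sum_eq_zero fun i _ => if_neg ?_
    simp only [Fin.val_last]
    omega
  have extend := Fin.sum_univ_castSucc (fun j : Fin (k + 1) => r j *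
    ((∑ i, w i) - ∑ i ∈ univ.filter (fun i : Fin (k + 1) => (i : ℕ) ≤ (j : ℕ)), w i))
  rw [last_term, mul_zero, add_zero] at extend
  simp only [Fin.val_castSucc] at extend
  rw [← extend]
  simp only [tail, mul_sum]
  simp only [sum_filter, sum_mul]
  rw [sum_comm]
  refine sum_congr rfl fun i _ => sum_congr rfl fun j _ => ?_
  split_ifs <;> simp

theorem one_sub_mul_pow_ne_zero {θ q : ℝ} (hθ0 : 0 < θ) (hθ1 : θ < 1) (hq0 : 0 < q) {m : ℕ}
    (hq : 1 < q → θ * q ^ (m - 1) < 1) {i : ℕ} (hi : i < m) : 1 - θ * q ^ i ≠ 0 := by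
  refine (sub_pos.2 ?_).ne'
  rcases lt_or_ge 1 q with h | h
  · refine lt_of_le_of_lt ?_ (hq h)
    gcongr
    · exact h.le
    · omega
  · exact (mul_le_of_le_one_right hθ0.le (pow_le_one₀ hq0.le h)).trans_lt hθ1

/-- Conditioning independent negative `q`-binomial random variables on their sum yields
the multivariate negative `q`-hypergeometric distribution (Theorem 3.5):
`(∏_{j=1}^{k+1} f_j(w_j)) / g(n) = q^{∑_{j=1}^{k} r_j(n−u_j)} (∏_{j=1}^{k+1}[r_j+w_j−1; w_j]_q)/[r+n−1; n]_q`. -/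
theorem negative_qBinomial_conditional_multivariate_negative_qHypergeometric
    (k : ℕ) (hk : 1 ≤ k) (θ q : ℝ) (hθ0 : 0 < θ) (hθ1 : θ < 1)
    (hq0 : 0 < q) (hq1 : q ≠ 1)
    (r : Fin (k + 1) → ℕ)
    (hq2 : 1 < q → θ * q ^ ((∑ j, r j) - 1) < 1)
    (w : Fin (k + 1) → ℕ) (n : ℕ) (hn : ∑ j, w j = n) :
    (∏ j : Fin (k + 1),
        qBinom q ((r j : ℝ) + (w j : ℝ) - 1) (w j) *
          (θ * q ^ (∑ i ∈ Finset.univ.filter (fun i : Fin (k + 1) => (i : ℕ) < (j : ℕ)), r i)) ^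
            (w j) *
          ∏ i ∈ Finset.range (r j),
            (1 - θ *
              q ^ ((∑ i' ∈ Finset.univ.filter (fun i' : Fin (k + 1) => (i' : ℕ) < (j : ℕ)), r i') +
                i))) /
      (qBinom q (((∑ j, r j : ℕ) : ℝ) + (n : ℝ) - 1) n * θ ^ n *
        ∏ i ∈ Finset.range (∑ j, r j), (1 - θ * q ^ i)) =
    q ^ (∑ j : Fin k,
          r j.castSucc *
            (n - ∑ i ∈ Finset.univ.filter (fun i : Fin (k + 1) => (i : ℕ) ≤ (j : ℕ)), w i)) *
      (∏ j : Fin (k + 1), qBinom q ((r j : ℝ) + (w j : ℝ) - 1) (w j)) /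
      qBinom q (((∑ j, r j : ℕ) : ℝ) + (n : ℝ) - 1) n := by
  have hprod : ∏ i ∈ range (∑ j, r j), (1 - θ * q ^ i) ≠ 0 :=
    prod_ne_zero_iff.2 fun i hi =>
      one_sub_mul_pow_ne_zero hθ0 hθ1 hq0 hq2 (mem_range.1 hi)
  have hpow : θ ^ n ≠ 0 := pow_ne_zero n hθ0.ne'
  rw [prod_mul_distrib, prod_mul_distrib,
    prod_range_partial_sums (fun i => 1 - θ * q ^ i), mul_div_mul_right _ _ hprod]
  subst hn
  rw [sum_mul_sub_partial_sums]
  simp only [mul_pow, ← pow_mul]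
  rw [prod_mul_distrib, prod_pow_eq_pow_sum, prod_pow_eq_pow_sum, mul_left_comm,
    mul_comm (qBinom _ _ _) (θ ^ _), mul_div_mul_left _ _ hpow, mul_comm]
end
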